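/- arXiv:0802.1361 — 3 statements merged into one kernel-verified Lean document; each statement's English description precedes it below -/
import Mathlib

section
/- Every triangulation graph of a polygon with n vertices, 3 ≤ n ≤ 7, admits a diagonal 2-dominating set of size at most ⌊(n+1)/3⌋. -/
open Finset

/-- Vertices `i` and `j` are consecutive on the Hamiltonian cycle of the `n`-gon. -/
def adjOnCycle (n : ℕ) (i j : Fin n) : Prop :=
  (i.val + 1) % n = j.val ∨ (j.val + 1) % n = i.val

instance (n : ℕ) (i j : Fin n) : Decidable (adjOnCycle n i j) := by
  unfold adjOnCycle; infer_instance

/-- A boundary edge of the polygon: a pair of consecutive vertices. -/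
def isBoundaryEdge (n : ℕ) (e : Finset (Fin n)) : Prop :=
  ∃ i j : Fin n, i ≠ j ∧ adjOnCycle n i j ∧ e = {i, j}

/-- A diagonal pair of the polygon: a pair of distinct non-consecutive vertices. -/
def isDiagPair (n : ℕ) (e : Finset (Fin n)) : Prop :=
  ∃ i j : Fin n, i ≠ j ∧ ¬ adjOnCycle n i j ∧ e = {i, j}

/-- Two chords of the convex `n`-gon cross (interleave strictly). -/
def crossing (n : ℕ) (e f : Finset (Fin n)) : Prop :=
  ∃ a b c d : Fin n, e = {a, b} ∧ f = {c, d} ∧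
    a.val < c.val ∧ c.val < b.val ∧ b.val < d.val

/-- A triangulation graph of a polygon with `n` vertices (a maximal outerplanar
graph): the vertices `Fin n` in convex position together with a maximal
(i.e. of cardinality `n - 3`) set of pairwise noncrossing diagonals. -/
structure PolyTriangulation (n : ℕ) where
  diags : Finset (Finset (Fin n))
  diags_valid : ∀ e ∈ diags, isDiagPair n e
  noncrossing : ∀ e ∈ diags, ∀ f ∈ diags, ¬ crossing n e f
  maximal : diags.card = n - 3

/-- An edge of the triangulation graph: a boundary edge or a diagonal. -/
def PolyTriangulation.isEdge {n : ℕ} (T : PolyTriangulation n) (e : Finset (Fin n)) : Prop :=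
  isBoundaryEdge n e ∨ e ∈ T.diags

/-- A triangular face of a maximal outerplanar graph is the same as a 3-cycle. -/
def PolyTriangulation.isTriangle {n : ℕ} (T : PolyTriangulation n) (t : Finset (Fin n)) : Prop :=
  ∃ a b c : Fin n, a ≠ b ∧ a ≠ c ∧ b ≠ c ∧ t = {a, b, c} ∧
    T.isEdge {a, b} ∧ T.isEdge {a, c} ∧ T.isEdge {b, c}

/-- A vertex is incident to (covered by) the set `D` of edges/diagonals. -/
def incidentTo {n : ℕ} (D : Finset (Finset (Fin n))) (v : Fin n) : Prop :=
  ∃ e ∈ D, v ∈ e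

/-- A (diagonal) 2-dominating set: a set of edges and diagonals of `T` such that
every triangular face has at least two of its vertices incident to the set. -/
def TwoDominating {n : ℕ} (T : PolyTriangulation n) (D : Finset (Finset (Fin n))) : Prop :=
  (∀ e ∈ D, T.isEdge e) ∧
  ∀ t, T.isTriangle t →
    2 ≤ (t.filter (fun v => ∃ e ∈ D, v ∈ e)).card

/-- An edge 2-dominating set: a set of boundary edges of `T` such that
every triangular face has at least two of its vertices incident to the set. -/
def EdgeTwoDominating {n : ℕ} (T : PolyTriangulation n) (D : Finset (Finset (Fin n))) : Prop :=
  (∀ e ∈ D, isBoundaryEdge n e) ∧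
  ∀ t, T.isTriangle t →
    2 ≤ (t.filter (fun v => ∃ e ∈ D, v ∈ e)).card

/-- All ordered pairs `i < j` that are diagonals of the `n`-gon. -/
def diagList (n : ℕ) : List (Fin n × Fin n) :=
  ((List.finRange n).product (List.finRange n)).filter
    (fun p => decide (p.1.val < p.2.val) && !decide (adjOnCycle n p.1 p.2))

def crossB {n : ℕ} (p q : Fin n × Fin n) : Bool :=
  Nat.blt p.1.val q.1.val && Nat.blt q.1.val p.2.val && Nat.blt p.2.val q.2.val

/-- All noncrossing sublists. -/
def genNC {n : ℕ} : List (Fin n × Fin n) → List (List (Fin n × Fin n))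
  | [] => [[]]
  | p :: ps => genNC ps ++
      ((genNC ps).filter (fun r => r.all (fun q => !crossB p q && !crossB q p))).map (p :: ·)

def edgeB {n : ℕ} (l : List (Fin n × Fin n)) (a b : Fin n) : Bool :=
  decide (adjOnCycle n a b) || l.any (fun p => (p.1 == a && p.2 == b) || (p.1 == b && p.2 == a))

def covB {n : ℕ} (e f : Fin n × Fin n) (v : Fin n) : Bool :=
  (v == e.1 || v == e.2) || (v == f.1 || v == f.2)

def goodB {n : ℕ} (l : List (Fin n × Fin n)) (e f : Fin n × Fin n) : Bool :=
  (List.finRange n).all fun a => (List.finRange n).all fun b =>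
    !(a != b && edgeB l a b) ||
    (List.finRange n).all fun c =>
      !(a != c && b != c && edgeB l a c && edgeB l b c) ||
      ((covB e f a && covB e f b) || (covB e f a && covB e f c) || (covB e f b && covB e f c))

def edgeList {n : ℕ} (l : List (Fin n × Fin n)) : List (Fin n × Fin n) :=
  ((List.finRange n).product (List.finRange n)).filter
    (fun p => Nat.blt p.1.val p.2.val && edgeB l p.1 p.2)

def checkB (n : ℕ) : Bool :=
  (genNC (diagList n)).all fun l =>
    !(Nat.ble (n - 3) l.length) ||
    (edgeList l).any fun e => (edgeList l).any fun f =>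
      (Nat.ble 5 n || e == f) && goodB l e f

theorem checkB_all (n : ℕ) (h3 : 3 ≤ n) (h7 : n ≤ 7) : checkB n = true := by
  interval_cases n <;> decide +kernel

theorem filter_mem_genNC {n : ℕ} (S : Fin n × Fin n → Bool)
    (hS : ∀ p q, S p = true → S q = true → crossB p q = false) (l : List (Fin n × Fin n)) :
    l.filter S ∈ genNC l := by
  induction l with
  | nil => simp [genNC]
  | cons p ps ih =>
    by_cases hp : S p = true
    · rw [List.filter_cons_of_pos hp]
      simp only [genNC, List.mem_append, List.mem_map, List.mem_filter]
      right
      refine ⟨_, ⟨ih, ?_⟩, rfl⟩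
      rw [List.all_eq_true]
      intro q hq
      have hq' := (List.mem_filter.1 hq).2
      simp [hS p q hp hq', hS q p hq' hp]
    · rw [List.filter_cons_of_neg hp]
      simp only [genNC, List.mem_append]
      exact Or.inl ih

theorem adjOnCycle_symm {n : ℕ} {a b : Fin n} (h : adjOnCycle n a b) : adjOnCycle n b a :=
  Or.symm h

theorem pair_eq_cases {α : Type*} [DecidableEq α] {a b c d : α}
    (h : ({a, b} : Finset α) = {c, d}) : (a = c ∧ b = d) ∨ (a = d ∧ b = c) := by
  have h1 : s(a, b) = s(c, d) := by
    have := congrArg (fun s : Finset α => (s : Set α)) h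
    simp only [Finset.coe_insert, Finset.coe_singleton] at this
    exact Sym2.eq_iff.2 (Set.pair_eq_pair_iff.1 this)
  exact Sym2.eq_iff.1 h1

/-- every triangulation graph of a polygon with `3 ≤ n ≤ 7` vertices
admits a diagonal 2-dominating set of size at most `⌊(n+1)/3⌋`. -/
theorem small_diag_two_dominating (n : ℕ) (h3 : 3 ≤ n) (h7 : n ≤ 7)
    (T : PolyTriangulation n) :
    ∃ D : Finset (Finset (Fin n)), TwoDominating T D ∧ D.card ≤ (n + 1) / 3 := by
  have hc := checkB_all n h3 h7
  set S : Fin n × Fin n → Bool := fun p => decide (({p.1, p.2} : Finset (Fin n)) ∈ T.diags) with hSdef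
  have hS : ∀ p q, S p = true → S q = true → crossB p q = false := by
    intro p q hp hq
    by_contra hcr
    simp only [crossB, Bool.not_eq_false, Bool.and_eq_true, Nat.blt_eq] at hcr
    exact T.noncrossing _ (of_decide_eq_true hp) _ (of_decide_eq_true hq)
      ⟨p.1, p.2, q.1, q.2, rfl, rfl, hcr.1.1, hcr.1.2, hcr.2⟩
  have hmem := filter_mem_genNC S hS (diagList n)
  set l := (diagList n).filter S with hl
  have hlmem : ∀ a b : Fin n, a.val < b.val → ({a, b} : Finset (Fin n)) ∈ T.diags → (a, b) ∈ l := by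
    intro a b hab h
    obtain ⟨i, j, hij, hadj, he⟩ := T.diags_valid _ h
    have hna : ¬ adjOnCycle n a b := by
      rcases pair_eq_cases he with ⟨rfl, rfl⟩ | ⟨rfl, rfl⟩
      · exact hadj
      · exact fun h => hadj (adjOnCycle_symm h)
    simp only [hl, diagList, List.mem_filter, hSdef, decide_eq_true_eq]
    refine ⟨⟨List.pair_mem_product.2 ⟨List.mem_finRange _, List.mem_finRange _⟩, ?_⟩, h⟩
    simp [hna]
    exact hab
  have hldiag : ∀ p ∈ l, ({p.1, p.2} : Finset (Fin n)) ∈ T.diags := by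
    intro p hp
    exact of_decide_eq_true (List.mem_filter.1 hp).2
  have hlen : n - 3 ≤ l.length := by
    rw [← T.maximal]
    have hsub : T.diags ⊆ (l.toFinset).image (fun p => ({p.1, p.2} : Finset (Fin n))) := by
      intro e he
      obtain ⟨i, j, hij, -, rfl⟩ := T.diags_valid _ he
      rw [Finset.mem_image]
      rcases lt_or_gt_of_ne (fun h => hij (Fin.ext h) : i.val ≠ j.val) with h | h
      · exact ⟨(i, j), List.mem_toFinset.2 (hlmem i j h he), rfl⟩
      · rw [Finset.pair_comm] at he ⊢
        exact ⟨(j, i), List.mem_toFinset.2 (hlmem j i h he), rfl⟩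
    exact (Finset.card_le_card hsub).trans (Finset.card_image_le.trans (List.toFinset_card_le l))
  have hedge : ∀ a b : Fin n, a ≠ b → (edgeB l a b = true ↔ T.isEdge {a, b}) := by
    intro a b hab
    simp only [edgeB, Bool.or_eq_true, decide_eq_true_eq, List.any_eq_true, Bool.and_eq_true,
      beq_iff_eq]
    constructor
    · rintro (h | ⟨p, hp, ⟨rfl, rfl⟩ | ⟨rfl, rfl⟩⟩)
      · exact Or.inl ⟨a, b, hab, h, rfl⟩
      · exact Or.inr (hldiag p hp)
      · rw [Finset.pair_comm]
        exact Or.inr (hldiag p hp)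
    · rintro (⟨i, j, hij, h, he⟩ | h)
      · left
        rcases pair_eq_cases he with ⟨rfl, rfl⟩ | ⟨rfl, rfl⟩
        · exact h
        · exact adjOnCycle_symm h
      · right
        rcases lt_or_gt_of_ne (fun h => hab (Fin.ext h) : a.val ≠ b.val) with h' | h'
        · exact ⟨(a, b), hlmem a b h' h, Or.inl ⟨rfl, rfl⟩⟩
        · rw [Finset.pair_comm] at h
          exact ⟨(b, a), hlmem b a h' h, Or.inr ⟨rfl, rfl⟩⟩
  have h1 := (List.all_eq_true.1 hc) l hmem
  rw [Nat.ble_eq_true_of_le hlen] at h1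
  simp only [Bool.not_true, Bool.false_or, List.any_eq_true, Bool.and_eq_true, Bool.or_eq_true,
    Nat.ble_eq, beq_iff_eq] at h1
  obtain ⟨e, he, f, hf, hef, hgood⟩ := h1
  have hE : ∀ p ∈ edgeList l, T.isEdge {p.1, p.2} := by
    intro p hp
    have h := (List.mem_filter.1 hp).2
    simp only [Bool.and_eq_true, Nat.blt_eq] at h
    exact (hedge _ _ (fun h' => by rw [h'] at h; exact lt_irrefl _ h.1)).1 h.2
  refine ⟨{{e.1, e.2}, {f.1, f.2}}, ⟨?_, ?_⟩, ?_⟩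
  · intro x hx
    simp only [Finset.mem_insert, Finset.mem_singleton] at hx
    rcases hx with rfl | rfl
    · exact hE e he
    · exact hE f hf
  · rintro t ⟨a, b, c, hab, hac, hbc, rfl, h1, h2, h3⟩
    have hcov : ∀ v, covB e f v = true →
        ∃ x ∈ ({{e.1, e.2}, {f.1, f.2}} : Finset (Finset (Fin n))), v ∈ x := by
      intro v hv
      simpa [covB] using hv
    have key : ∀ x y, x ∈ ({a, b, c} : Finset (Fin n)) → y ∈ ({a, b, c} : Finset (Fin n)) →
        x ≠ y → covB e f x = true → covB e f y = true →
        2 ≤ (({a, b, c} : Finset (Fin n)).filter (fun v => ∃ x ∈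
          ({{e.1, e.2}, {f.1, f.2}} : Finset (Finset (Fin n))), v ∈ x)).card := by
      intro x y hx hy hxy cx cy
      exact Finset.one_lt_card.2 ⟨x, Finset.mem_filter.2 ⟨hx, hcov x cx⟩,
        y, Finset.mem_filter.2 ⟨hy, hcov y cy⟩, hxy⟩
    have g1 := List.all_eq_true.1 (List.all_eq_true.1 hgood a (List.mem_finRange a)) b
      (List.mem_finRange b)
    rw [(hedge a b hab).2 h1, bne_iff_ne.2 hab] at g1
    simp only [Bool.and_true, Bool.not_true, Bool.false_or] at g1
    have g2 := List.all_eq_true.1 g1 c (List.mem_finRange c)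
    rw [(hedge a c hac).2 h2, (hedge b c hbc).2 h3, bne_iff_ne.2 hac, bne_iff_ne.2 hbc] at g2
    simp only [Bool.and_true, Bool.not_true, Bool.false_or, Bool.or_eq_true,
      Bool.and_eq_true] at g2
    rcases g2 with (⟨p, q⟩ | ⟨p, q⟩) | ⟨p, q⟩
    · exact key a b (by simp) (by simp) hab p q
    · exact key a c (by simp) (by simp) hac p q
    · exact key b c (by simp) (by simp) hbc p q
  · rcases hef with h | rfl
    · exact Finset.card_le_two.trans (by omega)
    · simp only [Finset.insert_eq_of_mem (Finset.mem_singleton_self _), Finset.card_singleton]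
      omega
end

section
/- Every triangulation graph of a polygon with n ≥ 3 vertices can be 2-dominated by at most ⌊(n+1)/3⌋ diagonal guards, i.e., there exists a set D of edges and diagonals of the triangulation graph with |D| ≤ ⌊(n+1)/3⌋ such that every triangular face has at least two of its vertices incident to elements of D. -/
open Finset

namespace DTD

/-- pairs of a family inside the interval `[i,j]`. -/
def ins (F : Finset (ℕ × ℕ)) (i j : ℕ) : Finset (ℕ × ℕ) :=
  F.filter (fun p => i ≤ p.1 ∧ p.2 ≤ j)

/-- edge relation: consecutive, or in the family. -/
def E (F : Finset (ℕ × ℕ)) (x y : ℕ) : Prop := y = x + 1 ∨ (x, y) ∈ F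

structure NC (F : Finset (ℕ × ℕ)) : Prop where
  gap : ∀ x y, (x, y) ∈ F → x + 2 ≤ y
  nc : ∀ x y z w, (x, y) ∈ F → (z, w) ∈ F → ¬ (x < z ∧ z < y ∧ y < w)

lemma NC.lt {F : Finset (ℕ × ℕ)} (h : NC F) {x y : ℕ} (e : E F x y) : x < y := by
  rcases e with e | e
  · omega
  · have := h.gap _ _ e; omega

/-- Existence of an apex for the chord `ij`. -/
lemma apex {F : Finset (ℕ × ℕ)} (h : NC F) (i j : ℕ) (hij : i + 2 ≤ j) :
    ∃ k, i < k ∧ k < j ∧ ∀ x y, i ≤ x → y ≤ j → E F x y →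
      (x = i ∧ y = j) ∨ y ≤ k ∨ k ≤ x := by
  classical
  have hne : ((Finset.Ioo i j).filter (fun k => E F i k)).Nonempty :=
    ⟨i + 1, Finset.mem_filter.2 ⟨Finset.mem_Ioo.2 ⟨by omega, by omega⟩, Or.inl rfl⟩⟩
  obtain ⟨k, hk, hmax⟩ := Finset.exists_max_image _ id hne
  simp only [Finset.mem_filter, Finset.mem_Ioo, id] at hk hmax
  refine ⟨k, hk.1.1, hk.1.2, ?_⟩
  intro x y hx hy hE
  have hxy := h.lt hE
  by_contra hcon
  push Not at hcon
  obtain ⟨h1, h2, h3⟩ := hcon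
  rcases Nat.eq_or_lt_of_le hx with rfl | hx
  · have := hmax y ⟨⟨hxy, lt_of_le_of_ne hy (h1 rfl)⟩, hE⟩
    omega
  · rcases hk.2 with e | e
    · omega
    · rcases hE with e' | e'
      · omega
      · exact h.nc _ _ _ _ e e' ⟨hx, h3, h2⟩

lemma ins_sub {F : Finset (ℕ × ℕ)} {i j k : ℕ}
    (hk : ∀ x y, i ≤ x → y ≤ j → E F x y → (x = i ∧ y = j) ∨ y ≤ k ∨ k ≤ x) :
    ins F i j ⊆ (F.filter (fun p => p = (i, j))) ∪ (ins F i k ∪ ins F k j) := by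
  rintro ⟨x, y⟩ hp
  simp only [ins, Finset.mem_filter, Finset.mem_union, Prod.mk.injEq] at hp ⊢
  have := hk x y hp.2.1 hp.2.2 (Or.inr hp.1)
  tauto

lemma card_base (F : Finset (ℕ × ℕ)) (i j : ℕ) :
    (F.filter (fun p => p = (i, j))).card ≤ 1 := by
  rw [Finset.card_le_one]
  intro a ha b hb
  simp only [Finset.mem_filter] at ha hb
  rw [ha.2, hb.2]

lemma ins_card_aux {F : Finset (ℕ × ℕ)} {i j k : ℕ}
    (hk : ∀ x y, i ≤ x → y ≤ j → E F x y → (x = i ∧ y = j) ∨ y ≤ k ∨ k ≤ x) :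
    (ins F i j).card ≤ (F.filter (fun p => p = (i, j))).card +
      ((ins F i k).card + (ins F k j).card) := by
  refine (Finset.card_le_card (ins_sub hk)).trans ?_
  refine (Finset.card_union_le _ _).trans ?_
  exact Nat.add_le_add_left (Finset.card_union_le _ _) _

lemma ins_card {F : Finset (ℕ × ℕ)} (h : NC F) : ∀ m i j : ℕ, j = i + m + 1 →
    (ins F i j).card ≤ m := by
  intro m
  induction m using Nat.strong_induction_on with
  | _ m ih =>
    intro i j hj
    rcases Nat.eq_zero_or_pos m with rfl | hm
    · rw [Nat.le_zero, Finset.card_eq_zero, Finset.eq_empty_iff_forall_notMem]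
      rintro ⟨x, y⟩ hp
      simp only [ins, Finset.mem_filter] at hp
      have := h.gap _ _ hp.1
      omega
    · obtain ⟨k, h1, h2, hk⟩ := apex h i j (by omega)
      have a := ins_card_aux hk
      have b := card_base F i j
      have c := ih (k - i - 1) (by omega) i k (by omega)
      have d := ih (j - k - 1) (by omega) k j (by omega)
      omega

/-- vertex `x` is covered by `D`. -/
def cov (D : Finset (ℕ × ℕ)) (x : ℕ) : Prop := ∃ p ∈ D, p.1 = x ∨ p.2 = x

/-- States: `0` externally covered, `1` no assumption, `2` required to be covered. -/
def dom (D : Finset (ℕ × ℕ)) (i j : ℕ) (a b : Fin 3) (x : ℕ) : Prop :=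
  cov D x ∨ (x = i ∧ a = 0) ∨ (x = j ∧ b = 0)

def G (F : Finset (ℕ × ℕ)) (i j : ℕ) (a b : Fin 3) (c : ℕ) : Prop :=
  ∃ D : Finset (ℕ × ℕ), D.card ≤ c ∧ (∀ p ∈ D, E F p.1 p.2 ∧ p.2 ≤ j) ∧
    (∀ x y, i ≤ x → y ≤ j → E F x y → dom D i j a b x ∨ dom D i j a b y) ∧
    (a = 2 → cov D i) ∧ (b = 2 → cov D j)

lemma G.mono {F : Finset (ℕ × ℕ)} {i j : ℕ} {a b : Fin 3} {c d : ℕ} (h : G F i j a b c)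
    (hcd : c ≤ d) : G F i j a b d := by
  obtain ⟨D, h1, h2⟩ := h
  exact ⟨D, h1.trans hcd, h2⟩

/-- compatible states at the apex -/
def compat (x y : Fin 3) : Prop := (x = 1 ∧ y = 1) ∨ (x = 2 ∧ y = 0) ∨ (x = 0 ∧ y = 2)

instance (x y : Fin 3) : Decidable (compat x y) := by unfold compat; infer_instance

lemma cov_union_l {D D' : Finset (ℕ × ℕ)} {x : ℕ} (h : cov D x) : cov (D ∪ D') x := by
  obtain ⟨p, hp, h⟩ := h
  exact ⟨p, Finset.mem_union_left _ hp, h⟩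

lemma cov_union_r {D D' : Finset (ℕ × ℕ)} {x : ℕ} (h : cov D' x) : cov (D ∪ D') x := by
  obtain ⟨p, hp, h⟩ := h
  exact ⟨p, Finset.mem_union_right _ hp, h⟩

/-- Gluing the two sides without using the base as a guard. -/
lemma glue {F : Finset (ℕ × ℕ)} {i j k : ℕ} (hij : i < k) (hkj : k < j)
    (hk : ∀ x y, i ≤ x → y ≤ j → E F x y → (x = i ∧ y = j) ∨ y ≤ k ∨ k ≤ x)
    {a b a' b' x y : Fin 3} {c d : ℕ}
    (hL : G F i k a' x c) (hR : G F k j y b' d) (hxy : compat x y)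
    (ha : a' = a ∨ a' = 2) (hb : b' = b ∨ b' = 2)
    (hbase : a' ≠ 1 ∨ b' ≠ 1) : G F i j a b (c + d) := by
  obtain ⟨D, hDc, hDE, hDd, hDa, hDx⟩ := hL
  obtain ⟨D', hDc', hDE', hDd', hDy', hDb'⟩ := hR
  have hi : a' ≠ 1 → dom (D ∪ D') i j a b i := by
    intro h
    have : a' = 0 ∨ a' = 2 := (by decide : ∀ u : Fin 3, u ≠ 1 → u = 0 ∨ u = 2) a' h
    rcases this with h | h
    · refine Or.inr (Or.inl ⟨rfl, ?_⟩)
      rcases ha with e | e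
      · rw [← e, h]
      · rw [e] at h; exact absurd h (by decide)
    · exact Or.inl (cov_union_l (hDa h))
  have hj : b' ≠ 1 → dom (D ∪ D') i j a b j := by
    intro h
    have : b' = 0 ∨ b' = 2 := (by decide : ∀ u : Fin 3, u ≠ 1 → u = 0 ∨ u = 2) b' h
    rcases this with h | h
    · refine Or.inr (Or.inr ⟨rfl, ?_⟩)
      rcases hb with e | e
      · rw [← e, h]
      · rw [e] at h; exact absurd h (by decide)
    · exact Or.inl (cov_union_r (hDb' h))
  have domL : ∀ z, dom D i k a' x z → dom (D ∪ D') i j a b z := by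
    rintro z (h | ⟨rfl, h⟩ | ⟨rfl, h⟩)
    · exact Or.inl (cov_union_l h)
    · exact hi (by rw [h]; decide)
    · rcases hxy with e | e | e
      · rw [e.1] at h; exact absurd h (by decide)
      · rw [e.1] at h; exact absurd h (by decide)
      · exact Or.inl (cov_union_r (hDy' e.2))
  have domR : ∀ z, dom D' k j y b' z → dom (D ∪ D') i j a b z := by
    rintro z (h | ⟨rfl, h⟩ | ⟨rfl, h⟩)
    · exact Or.inl (cov_union_r h)
    · rcases hxy with e | e | e
      · rw [e.2] at h; exact absurd h (by decide)
      · exact Or.inl (cov_union_l (hDx e.1))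
      · rw [e.2] at h; exact absurd h (by decide)
    · exact hj (by rw [h]; decide)
  refine ⟨D ∪ D', (Finset.card_union_le _ _).trans (Nat.add_le_add hDc hDc'), ?_, ?_, ?_, ?_⟩
  · intro p hp
    rcases Finset.mem_union.1 hp with hp | hp
    · exact ⟨(hDE p hp).1, (hDE p hp).2.trans hkj.le⟩
    · exact hDE' p hp
  · intro u v hu hv he
    rcases hk u v hu hv he with ⟨rfl, rfl⟩ | h | h
    · rcases hbase with h | h
      · exact Or.inl (hi h)
      · exact Or.inr (hj h)
    · exact (hDd u v hu h he).imp (domL u) (domL v)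
    · exact (hDd' u v h hv he).imp (domR u) (domR v)
  · intro h
    apply cov_union_l
    apply hDa
    rcases ha with e | e
    · rw [e, h]
    · exact e
  · intro h
    apply cov_union_r
    apply hDb'
    rcases hb with e | e
    · rw [e, h]
    · exact e

/-- Adding the base as a guard. -/
lemma addBase {F : Finset (ℕ × ℕ)} {i j : ℕ} (he : E F i j) {c : ℕ} (a b : Fin 3)
    (h : G F i j 0 0 c) : G F i j a b (1 + c) := by
  classical
  obtain ⟨D, hDc, hDE, hDd, -, -⟩ := h
  have ci : cov (insert (i, j) D) i := ⟨(i, j), Finset.mem_insert_self _ _, Or.inl rfl⟩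
  have cj : cov (insert (i, j) D) j := ⟨(i, j), Finset.mem_insert_self _ _, Or.inr rfl⟩
  have dm : ∀ z, dom D i j 0 0 z → dom (insert (i, j) D) i j a b z := by
    rintro z (⟨p, hp, h⟩ | ⟨rfl, h⟩ | ⟨rfl, h⟩)
    · exact Or.inl ⟨p, Finset.mem_insert_of_mem hp, h⟩
    · exact Or.inl ci
    · exact Or.inl cj
  refine ⟨insert (i, j) D, ?_, ?_, ?_, fun _ => ci, fun _ => cj⟩
  · have := Finset.card_insert_le (i, j) D
    omega
  · intro p hp
    rcases Finset.mem_insert.1 hp with rfl | hp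
    · exact ⟨he, le_rfl⟩
    · exact hDE p hp
  · intro u v hu hv h
    exact (hDd u v hu hv h).imp (dm u) (dm v)

/-- The four extremal profiles: cost table by states of the base endpoints. -/
def prof : Fin 4 → Fin 3 → Fin 3 → ℕ :=
  ![![![0, 0, 1], ![0, 1, 1], ![1, 1, 1]],
    ![![0, 1, 1], ![1, 1, 1], ![1, 1, 1]],
    ![![1, 1, 1], ![1, 1, 1], ![1, 2, 2]],
    ![![1, 1, 1], ![1, 1, 2], ![1, 1, 2]]]

def cls : Fin 4 → ℕ := ![0, 1, 2, 2]

/-- The finite check. -/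
lemma table : ∀ p q : Fin 4, ∃ r : Fin 4, ∃ δ : Fin 3, cls p + cls q + 1 = cls r + 3 * δ.val ∧
    ∀ a b : Fin 3,
      (∃ x y : Fin 3, compat x y ∧ 1 + (prof p 0 x + prof q y 0) ≤ prof r a b + δ.val) ∨
      (∃ a' b' x y : Fin 3, compat x y ∧ (a' = a ∨ a' = 2) ∧ (b' = b ∨ b' = 2) ∧
        (a' ≠ 1 ∨ b' ≠ 1) ∧ prof p a' x + prof q y b' ≤ prof r a b + δ.val) := by
  decide

lemma leafG {F : Finset (ℕ × ℕ)} (h : NC F) (i : ℕ) (a b : Fin 3) :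
    G F i (i + 1) a b (prof 0 a b) := by
  have hE : E F i (i + 1) := Or.inl rfl
  have base : ∀ a b : Fin 3, a ≠ 2 → b ≠ 2 → (a = 0 ∨ b = 0) → G F i (i + 1) a b 0 := by
    intro a b ha hb hab
    refine ⟨∅, by simp, by simp, ?_, fun h => absurd h ha, fun h => absurd h hb⟩
    intro x y hx hy he
    have := h.lt he
    have hx' : x = i := by omega
    have hy' : y = i + 1 := by omega
    rcases hab with h | h
    · exact Or.inl (Or.inr (Or.inl ⟨hx', h⟩))
    · exact Or.inr (Or.inr (Or.inr ⟨hy', h⟩))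
  have key : ∀ a b : Fin 3, (a ≠ 2 ∧ b ≠ 2 ∧ (a = 0 ∨ b = 0)) ∨ 1 + 0 ≤ prof 0 a b := by decide
  rcases key a b with ⟨h1, h2, h3⟩ | h1
  · exact (base a b h1 h2 h3).mono (Nat.zero_le _)
  · exact (addBase hE a b (base 0 0 (by decide) (by decide) (Or.inl rfl))).mono h1

lemma main {F : Finset (ℕ × ℕ)} (h : NC F) : ∀ m i j : ℕ, j = i + m + 1 →
    (ins F i j).card = m →
    ∃ p : Fin 4, ∃ q : ℕ, m = 3 * q + cls p ∧ ∀ a b, G F i j a b (prof p a b + q) := by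
  intro m
  induction m using Nat.strong_induction_on with
  | _ m ih =>
    intro i j hj hc
    rcases Nat.eq_zero_or_pos m with rfl | hm
    · refine ⟨0, 0, rfl, fun a b => ?_⟩
      subst hj
      exact leafG h i a b
    · obtain ⟨k, h1, h2, hk⟩ := apex h i j (by omega)
      have c0 := ins_card_aux hk
      have c1 := card_base F i j
      have c2 := ins_card h (k - i - 1) i k (by omega)
      have c3 := ins_card h (j - k - 1) k j (by omega)
      obtain ⟨p, s, hp, HL⟩ := ih (k - i - 1) (by omega) i k (by omega) (by omega)
      obtain ⟨q, t, hq, HR⟩ := ih (j - k - 1) (by omega) k j (by omega) (by omega)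
      have hb : (F.filter (fun p => p = (i, j))).card = 1 := by omega
      have hE : E F i j := by
        obtain ⟨w, hw⟩ := Finset.card_pos.1 (by rw [hb]; exact one_pos)
        simp only [Finset.mem_filter] at hw
        exact Or.inr (hw.2 ▸ hw.1)
      obtain ⟨r, δ, hr, H⟩ := table p q
      refine ⟨r, s + t + δ.val, by omega, fun a b => ?_⟩
      rcases H a b with ⟨x, y, hxy, hle⟩ | ⟨a', b', x, y, hxy, ha, hb, hn, hle⟩
      · have := glue h1 h2 hk (HL 0 x) (HR y 0) hxy (Or.inl rfl) (Or.inl rfl)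
          (Or.inl (by decide))
        exact (addBase hE a b this).mono (by omega)
      · exact (glue h1 h2 hk (HL a' x) (HR y b') hxy ha hb hn).mono (by omega)

/-- The set of vertices of `Fin n` given by a pair of naturals. -/
def e (n : ℕ) (p : ℕ × ℕ) : Finset (Fin n) :=
  Finset.univ.filter (fun v => v.val = p.1 ∨ v.val = p.2)

lemma e_eq {n : ℕ} (a b : Fin n) : e n (a.val, b.val) = {a, b} := by
  ext v
  simp [e, Fin.ext_iff]

/-- The diagonals as pairs of naturals, together with the base edge. -/
def fam {n : ℕ} (T : PolyTriangulation n) : Finset (ℕ × ℕ) :=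
  insert (0, n - 1) ((Finset.range n ×ˢ Finset.range n).filter
    (fun p => p.1 < p.2 ∧ e n p ∈ T.diags))

lemma diag_fam {n : ℕ} (T : PolyTriangulation n) (a b : Fin n) (hab : a < b)
    (h : {a, b} ∈ T.diags) : (a.val, b.val) ∈ (Finset.range n ×ˢ Finset.range n).filter
    (fun p => p.1 < p.2 ∧ e n p ∈ T.diags) := by
  simp only [Finset.mem_filter, Finset.mem_product, Finset.mem_range]
  exact ⟨⟨a.2, b.2⟩, hab, by rw [e_eq]; exact h⟩

lemma not_adj {n : ℕ} (T : PolyTriangulation n) (a b : Fin n)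
    (h : {a, b} ∈ T.diags) : ¬ adjOnCycle n a b := by
  obtain ⟨i, j, hij, hadj, he⟩ := T.diags_valid _ h
  have hi : i ∈ ({a, b} : Finset (Fin n)) := by rw [he]; simp
  have hj : j ∈ ({a, b} : Finset (Fin n)) := by rw [he]; simp
  simp only [Finset.mem_insert, Finset.mem_singleton] at hi hj
  unfold adjOnCycle at *
  rcases hi with rfl | rfl <;> rcases hj with rfl | rfl <;> tauto

lemma fam_cases {n : ℕ} {T : PolyTriangulation n} {x y : ℕ} (h : (x, y) ∈ fam T) :
    (x = 0 ∧ y = n - 1) ∨ ∃ a b : Fin n, a.val = x ∧ b.val = y ∧ x < y ∧ {a, b} ∈ T.diags := by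
  simp only [fam, Finset.mem_insert, Finset.mem_filter, Finset.mem_product, Finset.mem_range,
    Prod.mk.injEq] at h
  rcases h with h | ⟨⟨hx, hy⟩, hlt, hd⟩
  · exact Or.inl h
  · refine Or.inr ⟨⟨x, hx⟩, ⟨y, hy⟩, rfl, rfl, hlt, ?_⟩
    rw [← e_eq]; exact hd

lemma fam_NC {n : ℕ} (hn : 3 ≤ n) (T : PolyTriangulation n) : NC (fam T) := by
  constructor
  · intro x y h
    rcases fam_cases h with h | ⟨a, b, rfl, rfl, hlt, hd⟩
    · omega
    · by_contra hcon
      apply not_adj T a b hd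
      left
      rw [Nat.mod_eq_of_lt (by omega)]
      omega
  · rintro x y z w h1 h2 ⟨l1, l2, l3⟩
    rcases fam_cases h1 with h | ⟨a, b, rfl, rfl, hlt, hd⟩
    · rcases fam_cases h2 with h' | ⟨c, d, rfl, rfl, hlt', hd'⟩
      · omega
      · omega
    · rcases fam_cases h2 with h' | ⟨c, d, rfl, rfl, hlt', hd'⟩
      · omega
      · exact T.noncrossing _ hd _ hd' ⟨a, b, c, d, rfl, rfl, l1, l2, l3⟩

lemma fam_card {n : ℕ} (hn : 3 ≤ n) (T : PolyTriangulation n) : n - 2 ≤ (fam T).card := by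
  have hnot : (0, n - 1) ∉ (Finset.range n ×ˢ Finset.range n).filter
      (fun p => p.1 < p.2 ∧ e n p ∈ T.diags) := by
    intro h
    simp only [Finset.mem_filter] at h
    have h2 : e n (0, n - 1) = {(⟨0, by omega⟩ : Fin n), ⟨n - 1, by omega⟩} :=
      e_eq (⟨0, by omega⟩ : Fin n) ⟨n - 1, by omega⟩
    have h3 := h.2.2
    rw [h2] at h3
    apply not_adj T _ _ h3
    right
    simp only
    rw [Nat.sub_add_cancel (by omega), Nat.mod_self]
  rw [fam, Finset.card_insert_of_notMem hnot]
  have : T.diags ⊆ ((Finset.range n ×ˢ Finset.range n).filter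
      (fun p => p.1 < p.2 ∧ e n p ∈ T.diags)).image (e n) := by
    intro f hf
    obtain ⟨i, j, hij, -, rfl⟩ := T.diags_valid f hf
    rw [Finset.mem_image]
    rcases lt_or_gt_of_ne hij with h | h
    · exact ⟨_, diag_fam T i j h hf, e_eq i j⟩
    · rw [Finset.pair_comm] at hf ⊢
      exact ⟨_, diag_fam T j i h hf, e_eq j i⟩
  have h1 := (Finset.card_le_card this).trans Finset.card_image_le
  rw [T.maximal] at h1
  omega

lemma ins_fam {n : ℕ} (T : PolyTriangulation n) : ins (fam T) 0 (n - 1) = fam T := by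
  refine Finset.filter_true_of_mem ?_
  rintro ⟨x, y⟩ h
  rcases fam_cases h with h | ⟨a, b, rfl, rfl, hlt, hd⟩
  · exact ⟨Nat.zero_le _, h.2.le⟩
  · exact ⟨Nat.zero_le _, by simp only; omega⟩

lemma edge_E {n : ℕ} (T : PolyTriangulation n) (a b : Fin n) (hab : a < b)
    (h : T.isEdge {a, b}) : E (fam T) a.val b.val := by
  rcases h with ⟨i, j, hij, hadj, he⟩ | h
  · have hi : a ∈ ({i, j} : Finset (Fin n)) := by rw [← he]; simp
    have hj : b ∈ ({i, j} : Finset (Fin n)) := by rw [← he]; simp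
    simp only [Finset.mem_insert, Finset.mem_singleton] at hi hj
    have hab' : adjOnCycle n a b := by
      unfold adjOnCycle at *
      rcases hi with rfl | rfl <;> rcases hj with rfl | rfl <;> first | tauto | simp at hab
    have hlt : a.val < b.val := hab
    rcases hab' with h | h
    · rw [Nat.mod_eq_of_lt (by omega)] at h
      exact Or.inl h.symm
    · by_cases hb : b.val + 1 < n
      · rw [Nat.mod_eq_of_lt hb] at h
        omega
      · have hb' : b.val + 1 = n := by omega
        rw [hb', Nat.mod_self] at h
        right
        have : b.val = n - 1 := by omega
        rw [← h, this]
        exact Finset.mem_insert_self _ _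
  · exact Or.inr (Finset.mem_insert_of_mem (diag_fam T a b hab h))

lemma E_edge {n : ℕ} (hn : 3 ≤ n) (T : PolyTriangulation n) (x y : ℕ) (hy : y ≤ n - 1)
    (h : E (fam T) x y) : T.isEdge (e n (x, y)) := by
  rcases h with rfl | h
  · left
    refine ⟨⟨x, by omega⟩, ⟨x + 1, by omega⟩, by simp, Or.inl ?_, e_eq (⟨x, _⟩ : Fin n) ⟨x + 1, _⟩⟩
    simp only
    rw [Nat.mod_eq_of_lt (by omega)]
  · rcases fam_cases h with ⟨rfl, rfl⟩ | ⟨a, b, rfl, rfl, hlt, hd⟩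
    · left
      refine ⟨⟨0, by omega⟩, ⟨n - 1, by omega⟩, by simp; omega, Or.inr ?_,
        e_eq (⟨0, _⟩ : Fin n) ⟨n - 1, _⟩⟩
      simp only
      rw [Nat.sub_add_cancel (by omega), Nat.mod_self]
    · right
      rw [e_eq]; exact hd

lemma two_le {α : Type*} [DecidableEq α] (P : α → Prop) [DecidablePred P] (a b c : α)
    (hab : a ≠ b) (hac : a ≠ c) (hbc : b ≠ c) (h1 : P a ∨ P b) (h2 : P a ∨ P c)
    (h3 : P b ∨ P c) : 2 ≤ (({a, b, c} : Finset α).filter P).card := by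
  have key : ∀ x y : α, x ≠ y → x ∈ ({a, b, c} : Finset α) → y ∈ ({a, b, c} : Finset α) →
      P x → P y → 2 ≤ (({a, b, c} : Finset α).filter P).card := by
    intro x y hxy hx hy px py
    have : 1 < (({a, b, c} : Finset α).filter P).card :=
      Finset.one_lt_card.2 ⟨x, Finset.mem_filter.2 ⟨hx, px⟩, y, Finset.mem_filter.2 ⟨hy, py⟩, hxy⟩
    exact this
  by_cases ha : P a
  · rcases h3 with h | h
    · exact key a b hab (by simp) (by simp) ha h
    · exact key a c hac (by simp) (by simp) ha h
  · exact key b c hbc (by simp) (by simp) (h1.resolve_left ha) (h2.resolve_left ha)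

end DTD

/-- every triangulation graph of a polygon with `n ≥ 3` vertices can
be 2-dominated by at most `⌊(n+1)/3⌋` diagonal guards. -/
theorem diag_two_dominating (n : ℕ) (hn : 3 ≤ n) (T : PolyTriangulation n) :
    ∃ D : Finset (Finset (Fin n)), TwoDominating T D ∧ D.card ≤ (n + 1) / 3 := by
  classical
  have hNC := DTD.fam_NC hn T
  have hle := DTD.ins_card hNC (n - 2) 0 (n - 1) (by omega)
  have hge := DTD.fam_card hn T
  rw [DTD.ins_fam] at hle
  obtain ⟨p, q, hpq, H⟩ := DTD.main hNC (n - 2) 0 (n - 1) (by omega)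
    (by rw [DTD.ins_fam]; omega)
  obtain ⟨D, hDc, hDE, hDd, -, -⟩ := H 1 1
  have hp : DTD.prof p 1 1 = 1 := (by decide : ∀ u : Fin 4, DTD.prof u 1 1 = 1) p
  have hdom : ∀ z, DTD.dom D 0 (n - 1) 1 1 z → DTD.cov D z := by
    rintro z (h | ⟨-, h⟩ | ⟨-, h⟩)
    · exact h
    · exact absurd h (by decide)
    · exact absurd h (by decide)
  have hcov : ∀ v : Fin n, DTD.cov D v.val → ∃ f ∈ D.image (DTD.e n), v ∈ f := by
    rintro v ⟨r, hr, h⟩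
    refine ⟨DTD.e n r, Finset.mem_image_of_mem _ hr, ?_⟩
    simp only [DTD.e, Finset.mem_filter, Finset.mem_univ, true_and]
    exact h.imp Eq.symm Eq.symm
  have hlt : ∀ a b : Fin n, a < b → T.isEdge {a, b} →
      (∃ f ∈ D.image (DTD.e n), a ∈ f) ∨ (∃ f ∈ D.image (DTD.e n), b ∈ f) := by
    intro a b hab h
    have := hDd a.val b.val (Nat.zero_le _) (by omega) (DTD.edge_E T a b hab h)
    exact this.imp (fun h => hcov a (hdom _ h)) (fun h => hcov b (hdom _ h))
  have hall : ∀ a b : Fin n, a ≠ b → T.isEdge {a, b} →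
      (∃ f ∈ D.image (DTD.e n), a ∈ f) ∨ (∃ f ∈ D.image (DTD.e n), b ∈ f) := by
    intro a b hab h
    rcases lt_or_gt_of_ne hab with h' | h'
    · exact hlt a b h' h
    · rw [Finset.pair_comm] at h
      exact (hlt b a h' h).symm
  refine ⟨D.image (DTD.e n), ⟨?_, ?_⟩, ?_⟩
  · intro f hf
    obtain ⟨r, hr, rfl⟩ := Finset.mem_image.1 hf
    exact DTD.E_edge hn T r.1 r.2 (hDE r hr).2 (hDE r hr).1
  · rintro t ⟨a, b, c, hab, hac, hbc, rfl, e1, e2, e3⟩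
    convert DTD.two_le (fun v => ∃ f ∈ D.image (DTD.e n), v ∈ f) a b c hab hac hbc
      (hall a b hab e1) (hall a c hac e2) (hall b c hbc e3)
  · have := (Finset.card_image_le (s := D) (f := DTD.e n)).trans hDc
    omega
end

section
/- Every triangulation graph of a polygon with n ≥ 3 vertices, n ≠ 4, admits an edge 2-dominating set of size at most ⌊3n/7⌋; for n = 4 one additional edge is required (size 2). -/
open Finset

namespace ETD

/-- chords as ordered pairs; adjacency inside the path `0,1,2,...` plus chords -/
def Adj (S : Finset (ℕ × ℕ)) (a b : ℕ) : Prop := b = a + 1 ∨ (a, b) ∈ S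

/-- well-formed noncrossing set of chords -/
def NC (S : Finset (ℕ × ℕ)) : Prop :=
  (∀ a b, (a, b) ∈ S → a + 2 ≤ b) ∧
  ∀ a b c d, (a, b) ∈ S → (c, d) ∈ S → a < c → c < b → b < d → False

/-- chords of `S` inside `[i,j]` -/
def inside (S : Finset (ℕ × ℕ)) (i j : ℕ) : Finset (ℕ × ℕ) :=
  S.filter (fun p => i ≤ p.1 ∧ p.2 ≤ j)

lemma decomp {S : Finset (ℕ × ℕ)} (hS : NC S) {i j : ℕ} (h : i + 2 ≤ j) :
    ∃ m, i < m ∧ m < j ∧ inside S i j ⊆ inside S i m ∪ inside S m j ∪ {(i, j)} := by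
  classical
  let F := (Finset.Ioo i j).filter (fun m => Adj S i m)
  have hF : F.Nonempty := ⟨i + 1, by
    simp only [F, Finset.mem_filter, Finset.mem_Ioo]
    exact ⟨⟨by omega, by omega⟩, Or.inl rfl⟩⟩
  have hmem := F.max'_mem hF
  have hmax : ∀ b ∈ F, b ≤ F.max' hF := fun b hb => F.le_max' b hb
  generalize F.max' hF = m at hmem hmax
  simp only [F, Finset.mem_filter, Finset.mem_Ioo] at hmem hmax
  obtain ⟨⟨h1, h2⟩, h3⟩ := hmem
  refine ⟨m, h1, h2, ?_⟩
  rintro ⟨a, b⟩ hab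
  simp only [inside, Finset.mem_filter, Finset.mem_union, Finset.mem_singleton, Prod.mk.injEq]
    at hab ⊢
  obtain ⟨hab, ha, hb⟩ := hab
  by_cases c1 : b ≤ m
  · exact Or.inl (Or.inl ⟨hab, ha, c1⟩)
  by_cases c2 : m ≤ a
  · exact Or.inl (Or.inr ⟨hab, c2, hb⟩)
  right
  have hai : a = i := by
    by_contra hne
    rcases h3 with h3 | h3
    · omega
    · exact hS.2 i m a b h3 hab (by omega) (by omega) (by omega)
  subst hai
  refine ⟨rfl, ?_⟩
  by_contra hne
  exact c1 (hmax b ⟨⟨by omega, by omega⟩, Or.inr hab⟩)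

lemma inside_card {S : Finset (ℕ × ℕ)} (hS : NC S) :
    ∀ k i j, j = i + k → 1 ≤ k → (inside S i j).card + 1 ≤ k := by
  intro k
  induction k using Nat.strong_induction_on with
  | _ k ih =>
    intro i j hj hk
    by_cases h1 : k = 1
    · have : inside S i j = ∅ := by
        apply Finset.eq_empty_of_forall_notMem
        rintro ⟨a, b⟩ hab
        simp only [inside, Finset.mem_filter] at hab
        have := hS.1 a b hab.1
        omega
      rw [this]; simp [h1]
    · obtain ⟨m, hm1, hm2, hsub⟩ := decomp hS (i := i) (j := j) (by omega)
      have e1 := Finset.card_le_card hsub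
      have e2 := Finset.card_union_le (inside S i m ∪ inside S m j) {(i, j)}
      have e3 := Finset.card_union_le (inside S i m) (inside S m j)
      have e4 := ih (m - i) (by omega) i m (by omega) (by omega)
      have e5 := ih (j - m) (by omega) m j (by omega) (by omega)
      rw [Finset.card_singleton] at e2
      omega

def Tight (S : Finset (ℕ × ℕ)) (i j : ℕ) : Prop := i < j ∧ j ≤ (inside S i j).card + 1 + i

lemma tight_adj {S : Finset (ℕ × ℕ)} (hS : NC S) {i j : ℕ} (h : Tight S i j) : Adj S i j := by
  by_contra hn
  simp only [Adj, not_or] at hn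
  obtain ⟨h0, h⟩ := h
  obtain ⟨m, hm1, hm2, hsub⟩ := decomp hS (i := i) (j := j) (by omega)
  have hsub' : inside S i j ⊆ inside S i m ∪ inside S m j := by
    intro p hp
    have := hsub hp
    simp only [Finset.mem_union, Finset.mem_singleton] at this ⊢
    rcases this with this | this
    · exact this
    · subst this
      exact absurd (Finset.mem_filter.1 hp).1 hn.2
  have e1 := Finset.card_le_card hsub'
  have e3 := Finset.card_union_le (inside S i m) (inside S m j)
  have e4 := inside_card hS (m - i) i m (by omega) (by omega)
  have e5 := inside_card hS (j - m) m j (by omega) (by omega)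
  omega

lemma tight_split {S : Finset (ℕ × ℕ)} (hS : NC S) {i j : ℕ} (h : Tight S i j)
    (hij : i + 2 ≤ j) : ∃ m, Tight S i m ∧ Tight S m j := by
  obtain ⟨h0, h⟩ := h
  obtain ⟨m, hm1, hm2, hsub⟩ := decomp hS hij
  have e1 := Finset.card_le_card hsub
  have e2 := Finset.card_union_le (inside S i m ∪ inside S m j) {(i, j)}
  have e3 := Finset.card_union_le (inside S i m) (inside S m j)
  have e4 := inside_card hS (m - i) i m (by omega) (by omega)
  have e5 := inside_card hS (j - m) m j (by omega) (by omega)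
  rw [Finset.card_singleton] at e2
  exact ⟨m, ⟨hm1, by omega⟩, ⟨hm2, by omega⟩⟩

lemma adj_nc {S : Finset (ℕ × ℕ)} (hS : NC S) {a b c d : ℕ} (h1 : Adj S a b) (h2 : Adj S c d)
    (h3 : a < c) (h4 : c < b) (h5 : b < d) : False := by
  rcases h1 with h1 | h1
  · omega
  rcases h2 with h2 | h2
  · omega
  exact hS.2 a b c d h1 h2 h3 h4 h5

/-- `v` is covered by the path edges `{m,m+1}`, `m ∈ D`, or by an outside promise at an end. -/
def Cov (i j : ℕ) (x y : Fin 3) (D : Finset ℕ) (v : ℕ) : Prop :=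
  v ∈ D ∨ (∃ m ∈ D, m + 1 = v) ∨ (v = i ∧ x = 1) ∨ (v = j ∧ y = 1)

/-- End states: `0` nothing promised, `1` end is covered from outside,
`2` end has to be covered from inside. -/
def Feas (S : Finset (ℕ × ℕ)) (i j : ℕ) (x y : Fin 3) (t : ℕ) : Prop :=
  ∃ D : Finset ℕ, (∀ m ∈ D, i ≤ m ∧ m < j) ∧ D.card ≤ t ∧ (x = 2 → i ∈ D) ∧
    (y = 2 → ∃ m ∈ D, m + 1 = j) ∧
    ∀ a b c, i ≤ a → a < b → b < c → c ≤ j → Adj S a b → Adj S b c → Adj S a c →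
      (Cov i j x y D a ∧ Cov i j x y D b) ∨ (Cov i j x y D a ∧ Cov i j x y D c) ∨
      (Cov i j x y D b ∧ Cov i j x y D c)

lemma Feas.mono {S : Finset (ℕ × ℕ)} {i j : ℕ} {x y : Fin 3} {s t : ℕ}
    (h : Feas S i j x y s) (hst : s ≤ t) : Feas S i j x y t := by
  obtain ⟨D, h1, h2, h3⟩ := h
  exact ⟨D, h1, h2.trans hst, h3⟩

/-- relaxation of an end state -/
def Rel (x x' : Fin 3) : Prop := x' = x ∨ (x = 0 ∧ x' = 2)

instance (x x' : Fin 3) : Decidable (Rel x x') := by unfold Rel; infer_instance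

lemma Feas.relax {S : Finset (ℕ × ℕ)} {i j : ℕ} {x y x' y' : Fin 3} {t : ℕ}
    (h : Feas S i j x' y' t) (hx : Rel x x') (hy : Rel y y') : Feas S i j x y t := by
  obtain ⟨D, h1, h2, h3, h4, h5⟩ := h
  have hx1 : x' = 1 → x = 1 := by rcases hx with h | ⟨h, h'⟩ <;> simp_all
  have hy1 : y' = 1 → y = 1 := by rcases hy with h | ⟨h, h'⟩ <;> simp_all
  have hc : ∀ v, Cov i j x' y' D v → Cov i j x y D v := by
    rintro v (h | h | ⟨h, h'⟩ | ⟨h, h'⟩)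
    · exact Or.inl h
    · exact Or.inr (Or.inl h)
    · exact Or.inr (Or.inr (Or.inl ⟨h, hx1 h'⟩))
    · exact Or.inr (Or.inr (Or.inr ⟨h, hy1 h'⟩))
  refine ⟨D, h1, h2, ?_, ?_, ?_⟩
  · intro h; apply h3; rcases hx with h' | ⟨h', h''⟩ <;> simp_all
  · intro h; apply h4; rcases hy with h' | ⟨h', h''⟩ <;> simp_all
  · intro a b c g1 g2 g3 g4 g5 g6 g7
    rcases h5 a b c g1 g2 g3 g4 g5 g6 g7 with h | h | h
    · exact Or.inl ⟨hc _ h.1, hc _ h.2⟩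
    · exact Or.inr (Or.inl ⟨hc _ h.1, hc _ h.2⟩)
    · exact Or.inr (Or.inr ⟨hc _ h.1, hc _ h.2⟩)

/-- admissible middle states -/
def Valid (x u v y : Fin 3) : Prop :=
  (u = 0 ∧ v = 0 ∧ x ≠ 0 ∧ y ≠ 0) ∨
    (((u = 1 ∧ v = 2) ∨ (u = 2 ∧ v = 1)) ∧ (x ≠ 0 ∨ y ≠ 0))

instance (x u v y : Fin 3) : Decidable (Valid x u v y) := by unfold Valid; infer_instance

lemma Feas.node {S : Finset (ℕ × ℕ)} (hS : NC S) {i m j : ℕ} {x u v y : Fin 3} {s t : ℕ}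
    (him : Tight S i m) (hmj : Tight S m j) (h1 : Feas S i m x u s) (h2 : Feas S m j v y t)
    (hv : Valid x u v y) : Feas S i j x y (s + t) := by
  have a1 := tight_adj hS him
  have a2 := tight_adj hS hmj
  have l1 := him.1
  have l2 := hmj.1
  obtain ⟨D, d1, d2, d3, d4, d5⟩ := h1
  obtain ⟨E, e1, e2, e3, e4, e5⟩ := h2
  have hDm : u = 2 → Cov i j x y (D ∪ E) m := by
    intro h
    obtain ⟨w, hw, hw'⟩ := d4 h
    exact Or.inr (Or.inl ⟨w, Finset.mem_union_left _ hw, hw'⟩)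
  have hEm : v = 2 → Cov i j x y (D ∪ E) m := by
    intro h
    exact Or.inl (Finset.mem_union_right _ (e3 h))
  have hm : u = 1 ∨ v = 1 ∨ u = 2 ∨ v = 2 → Cov i j x y (D ∪ E) m := by
    intro h
    have : u = 2 ∨ v = 2 := by
      rcases hv with ⟨rfl, rfl, _⟩ | ⟨⟨rfl, rfl⟩ | ⟨rfl, rfl⟩, _⟩ <;> simp_all
    exact this.elim hDm hEm
  have hi : x ≠ 0 → Cov i j x y (D ∪ E) i := by
    intro h
    have : x = 1 ∨ x = 2 := by omega
    rcases this with h | h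
    · exact Or.inr (Or.inr (Or.inl ⟨rfl, h⟩))
    · exact Or.inl (Finset.mem_union_left _ (d3 h))
  have hj : y ≠ 0 → Cov i j x y (D ∪ E) j := by
    intro h
    have : y = 1 ∨ y = 2 := by omega
    rcases this with h | h
    · exact Or.inr (Or.inr (Or.inr ⟨rfl, h⟩))
    · obtain ⟨w, hw, hw'⟩ := e4 h
      exact Or.inr (Or.inl ⟨w, Finset.mem_union_right _ hw, hw'⟩)
  have cD : ∀ w, Cov i m x u D w → Cov i j x y (D ∪ E) w := by
    rintro w (h | ⟨z, h, h'⟩ | ⟨h, h'⟩ | ⟨h, h'⟩)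
    · exact Or.inl (Finset.mem_union_left _ h)
    · exact Or.inr (Or.inl ⟨z, Finset.mem_union_left _ h, h'⟩)
    · exact Or.inr (Or.inr (Or.inl ⟨h, h'⟩))
    · subst h; exact hm (Or.inl h')
  have cE : ∀ w, Cov m j v y E w → Cov i j x y (D ∪ E) w := by
    rintro w (h | ⟨z, h, h'⟩ | ⟨h, h'⟩ | ⟨h, h'⟩)
    · exact Or.inl (Finset.mem_union_right _ h)
    · exact Or.inr (Or.inl ⟨z, Finset.mem_union_right _ h, h'⟩)
    · subst h; exact hm (Or.inr (Or.inl h'))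
    · exact Or.inr (Or.inr (Or.inr ⟨h, h'⟩))
  refine ⟨D ∪ E, ?_, ?_, ?_, ?_, ?_⟩
  · intro w hw
    rcases Finset.mem_union.1 hw with h | h
    · have := d1 w h; omega
    · have := e1 w h; omega
  · have := Finset.card_union_le D E; omega
  · intro h; exact Finset.mem_union_left _ (d3 h)
  · intro h
    obtain ⟨w, hw, hw'⟩ := e4 h
    exact ⟨w, Finset.mem_union_right _ hw, hw'⟩
  · intro a b c g1 g2 g3 g4 g5 g6 g7
    by_cases k1 : c ≤ m
    · rcases d5 a b c g1 g2 g3 k1 g5 g6 g7 with h | h | h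
      · exact Or.inl ⟨cD _ h.1, cD _ h.2⟩
      · exact Or.inr (Or.inl ⟨cD _ h.1, cD _ h.2⟩)
      · exact Or.inr (Or.inr ⟨cD _ h.1, cD _ h.2⟩)
    by_cases k2 : m ≤ a
    · rcases e5 a b c k2 g2 g3 g4 g5 g6 g7 with h | h | h
      · exact Or.inl ⟨cE _ h.1, cE _ h.2⟩
      · exact Or.inr (Or.inl ⟨cE _ h.1, cE _ h.2⟩)
      · exact Or.inr (Or.inr ⟨cE _ h.1, cE _ h.2⟩)
    have ha : a = i := by
      by_contra hne
      exact adj_nc hS a1 g7 (by omega) (by omega) (by omega)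
    have hc : c = j := by
      by_contra hne
      exact adj_nc hS g7 a2 (by omega) (by omega) (by omega)
    have hb : b = m := by
      rcases lt_trichotomy b m with h | h | h
      · exact (adj_nc hS a1 g6 (by omega) (by omega) (by omega)).elim
      · exact h
      · exact (adj_nc hS g5 a2 (by omega) (by omega) (by omega)).elim
    subst ha hb hc
    rcases hv with ⟨_, _, k3, k4⟩ | ⟨k3, k4⟩
    · exact Or.inr (Or.inl ⟨hi k3, hj k4⟩)
    · have hb := hm (by
        rcases k3 with ⟨k3, _⟩ | ⟨k3, _⟩
        · exact Or.inl k3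
        · exact Or.inr (Or.inr (Or.inl k3)))
      rcases k4 with k4 | k4
      · exact Or.inl ⟨hi k4, hb⟩
      · exact Or.inr (Or.inr ⟨hb, hj k4⟩)

/-- Bounds for the nine end states; worst cases by number of path edges. -/
def tab : ℕ → List (List ℕ)
  | 1 => [[0, 0, 1, 0, 0, 1, 1, 1, 1]]
  | 2 => [[1, 1, 1, 1, 0, 1, 1, 1, 2]]
  | 3 => [[2, 1, 2, 1, 1, 1, 2, 1, 2]]
  | 4 => [[2, 1, 2, 2, 1, 2, 2, 2, 2], [2, 2, 2, 1, 1, 2, 2, 2, 2]]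
  | 5 => [[2, 2, 2, 2, 1, 2, 3, 2, 3], [2, 2, 2, 2, 2, 2, 2, 2, 3], [2, 2, 3, 2, 1, 2, 2, 2, 3]]
  | 6 => [[3, 2, 3, 2, 2, 2, 3, 3, 3], [3, 2, 3, 2, 2, 3, 3, 2, 3]]
  | 7 => [[3, 2, 3, 3, 2, 3, 3, 3, 4], [3, 3, 3, 2, 2, 3, 3, 3, 4], [3, 3, 3, 3, 2, 3, 3, 3, 3]]
  | 8 => [[3, 3, 3, 3, 3, 3, 4, 3, 4], [3, 3, 4, 3, 3, 3, 3, 3, 4], [4, 3, 4, 3, 2, 3, 4, 3, 4]]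
  | _ => []

def val (T : List ℕ) (x y : Fin 3) : ℕ := T.getD (3 * x.val + y.val) 0

def Opt (L R : List ℕ) (x y : Fin 3) (bd : ℕ) : Prop :=
  ∃ x' u v y' : Fin 3, Rel x x' ∧ Rel y y' ∧ Valid x' u v y' ∧ val L x' u + val R v y' ≤ bd

instance (L R : List ℕ) (x y : Fin 3) (bd : ℕ) : Decidable (Opt L R x y bd) := by
  unfold Opt; infer_instance

/-- how many times 5 is subtracted -/
def dec (r : ℕ) : ℕ := (r - 4) / 5

lemma closed : ∀ r₁ ∈ List.range 9, ∀ r₂ ∈ List.range 9, ∀ L ∈ tab r₁, ∀ R ∈ tab r₂,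
    ∃ T ∈ tab (r₁ + r₂ - 5 * dec (r₁ + r₂)), ∀ x y : Fin 3,
      Opt L R x y (val T x y + 2 * dec (r₁ + r₂)) := by
  decide +kernel

lemma feas_leaf (S : Finset (ℕ × ℕ)) (i : ℕ) : ∀ x y : Fin 3,
    Feas S i (i + 1) x y (val [0, 0, 1, 0, 0, 1, 1, 1, 1] x y) := by
  intro x y
  by_cases h : x = 2 ∨ y = 2
  · refine ⟨{i}, by simp, ?_, by simp, by simp, by intros; omega⟩
    rw [Finset.card_singleton]
    revert h; revert x y; decide
  · refine ⟨∅, by simp, by simp, by tauto, by tauto, by intros; omega⟩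

lemma main {S : Finset (ℕ × ℕ)} (hS : NC S) : ∀ k i j, j = i + k → Tight S i j →
    ∃ r q, k = r + 5 * q ∧ r < 9 ∧ 1 ≤ r ∧ (0 < q → 4 ≤ r) ∧ ∃ T ∈ tab r,
      ∀ x y : Fin 3, Feas S i j x y (val T x y + 2 * q) := by
  intro k
  induction k using Nat.strong_induction_on with
  | _ k ih =>
    intro i j hj ht
    have h0 := ht.1
    by_cases h1 : k = 1
    · subst h1 hj
      exact ⟨1, 0, rfl, by norm_num, le_refl _, by simp, _, List.mem_singleton.2 rfl,
        feas_leaf S i⟩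
    · obtain ⟨m, hm1, hm2⟩ := tight_split hS ht (by omega)
      have := hm1.1
      have := hm2.1
      obtain ⟨r₁, q₁, a1, a2, a3, a4, L, hL, fL⟩ := ih (m - i) (by omega) i m (by omega) hm1
      obtain ⟨r₂, q₂, b1, b2, b3, b4, R, hR, fR⟩ := ih (j - m) (by omega) m j (by omega) hm2
      obtain ⟨T, hT, fT⟩ := closed r₁ (List.mem_range.2 a2) r₂ (List.mem_range.2 b2) L hL R hR
      refine ⟨r₁ + r₂ - 5 * dec (r₁ + r₂), q₁ + q₂ + dec (r₁ + r₂), ?_, ?_, ?_, ?_, T, hT, ?_⟩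
      · unfold dec; omega
      · unfold dec; omega
      · unfold dec; omega
      · unfold dec; omega
      · intro x y
        obtain ⟨x', u, v, y', o1, o2, o3, o4⟩ := fT x y
        exact ((Feas.node hS hm1 hm2 (fL x' u) (fR v y') o3).relax o1 o2).mono (by omega)

lemma final_tab : ∀ r ∈ List.range 9, r = 2 ∨ 4 ≤ r → ∀ T ∈ tab r,
    val T 0 0 ≤ (2 * r + 3) / 5 ∨ val T 1 1 + 1 ≤ (2 * r + 3) / 5 := by
  decide +kernel

lemma final {S : Finset (ℕ × ℕ)} (hS : NC S) {n : ℕ} (hn : 3 ≤ n) (hn4 : n ≠ 4)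
    (ht : Tight S 0 (n - 1)) :
    Feas S 0 (n - 1) 0 0 (3 * n / 7) ∨ ∃ t, t + 1 ≤ 3 * n / 7 ∧ Feas S 0 (n - 1) 1 1 t := by
  obtain ⟨r, q, h1, h2, h3, h4, T, hT, fT⟩ := main hS (n - 1) 0 (n - 1) (by omega) ht
  rcases final_tab r (List.mem_range.2 h2) (by omega) T hT with h | h
  · exact Or.inl ((fT 0 0).mono (by omega))
  · exact Or.inr ⟨_, by omega, fT 1 1⟩

end ETD

namespace ETD

/-- vertices with value `a` or `b` -/
def pair (n a b : ℕ) : Finset (Fin n) := Finset.univ.filter (fun v => v.val = a ∨ v.val = b)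

lemma mem_pair {n a b : ℕ} {v : Fin n} : v ∈ pair n a b ↔ v.val = a ∨ v.val = b := by
  simp [pair]

lemma pair_eq {n : ℕ} (a b : Fin n) : pair n a.val b.val = {a, b} := by
  ext v
  rw [mem_pair]
  simp [Fin.ext_iff]

def pr (n m : ℕ) : Finset (Fin n) := pair n m (m + 1)

def rootEdge (n : ℕ) : Finset (Fin n) := pair n 0 (n - 1)

lemma mem_pr {n m : ℕ} {v : Fin n} : v ∈ pr n m ↔ v.val = m ∨ v.val = m + 1 := mem_pair

lemma mem_root {n : ℕ} {v : Fin n} : v ∈ rootEdge n ↔ v.val = 0 ∨ v.val = n - 1 := mem_pair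

lemma pr_boundary {n m : ℕ} (_hn : 3 ≤ n) (hm : m + 1 < n) : isBoundaryEdge n (pr n m) := by
  refine ⟨⟨m, by omega⟩, ⟨m + 1, hm⟩, ?_, ?_, ?_⟩
  · simp
  · left; exact Nat.mod_eq_of_lt hm
  · exact pair_eq (⟨m, by omega⟩ : Fin n) ⟨m + 1, hm⟩

lemma root_boundary {n : ℕ} (hn : 3 ≤ n) : isBoundaryEdge n (rootEdge n) := by
  refine ⟨⟨0, by omega⟩, ⟨n - 1, by omega⟩, ?_, ?_, ?_⟩
  · rw [Ne, Fin.ext_iff]; simp only; omega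
  · right
    show (n - 1 + 1) % n = 0
    rw [Nat.sub_add_cancel (by omega), Nat.mod_self]
  · exact pair_eq (⟨0, by omega⟩ : Fin n) ⟨n - 1, by omega⟩

/-- diagonals as ordered pairs -/
def dpairs {n : ℕ} (T : PolyTriangulation n) : Finset (ℕ × ℕ) :=
  (Finset.range n ×ˢ Finset.range n).filter (fun p => p.1 < p.2 ∧ pair n p.1 p.2 ∈ T.diags)

def chords {n : ℕ} (T : PolyTriangulation n) : Finset (ℕ × ℕ) := insert (0, n - 1) (dpairs T)

lemma mem_dpairs {n : ℕ} {T : PolyTriangulation n} {a b : ℕ} :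
    (a, b) ∈ dpairs T ↔ a < b ∧ b < n ∧ pair n a b ∈ T.diags := by
  simp only [dpairs, Finset.mem_filter, Finset.mem_product, Finset.mem_range]
  constructor
  · rintro ⟨⟨_, h1⟩, h2, h3⟩; exact ⟨h2, h1, h3⟩
  · rintro ⟨h1, h2, h3⟩; exact ⟨⟨by omega, h2⟩, h1, h3⟩

lemma succ_mod {n a : ℕ} (h : a < n) :
    (a + 1 < n ∧ (a + 1) % n = a + 1) ∨ (a + 1 = n ∧ (a + 1) % n = 0) := by
  rcases Nat.lt_or_ge (a + 1) n with h' | h'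
  · exact Or.inl ⟨h', Nat.mod_eq_of_lt h'⟩
  · have : a + 1 = n := by omega
    exact Or.inr ⟨this, by rw [this, Nat.mod_self]⟩

lemma pair_vals {n : ℕ} {a b : ℕ} (hab : a < b) (hb : b < n) {i j : Fin n}
    (h : pair n a b = {i, j}) : (i.val = a ∧ j.val = b) ∨ (i.val = b ∧ j.val = a) := by
  have h1 : i ∈ pair n a b := by rw [h]; simp
  have h2 : j ∈ pair n a b := by rw [h]; simp
  have h3 : (⟨a, by omega⟩ : Fin n) ∈ ({i, j} : Finset (Fin n)) := by
    rw [← h]; exact mem_pair.2 (Or.inl rfl)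
  have h4 : (⟨b, hb⟩ : Fin n) ∈ ({i, j} : Finset (Fin n)) := by
    rw [← h]; exact mem_pair.2 (Or.inr rfl)
  rw [mem_pair] at h1 h2
  simp only [Finset.mem_insert, Finset.mem_singleton, Fin.ext_iff] at h3 h4
  omega

lemma dpairs_spec {n : ℕ} {T : PolyTriangulation n} {a b : ℕ} (h : (a, b) ∈ dpairs T) :
    a + 2 ≤ b ∧ b < n ∧ ¬ (a = 0 ∧ b = n - 1) := by
  obtain ⟨h1, h2, h3⟩ := mem_dpairs.1 h
  obtain ⟨i, j, hij, hadj, he⟩ := T.diags_valid _ h3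
  have hv := pair_vals h1 h2 he
  simp only [adjOnCycle, not_or] at hadj
  have m1 := succ_mod i.isLt
  have m2 := succ_mod j.isLt
  omega

lemma chords_nc {n : ℕ} (T : PolyTriangulation n) (hn : 3 ≤ n) : NC (chords T) := by
  constructor
  · intro a b h
    rcases Finset.mem_insert.1 h with h | h
    · rw [Prod.mk.injEq] at h; omega
    · exact (dpairs_spec h).1
  · intro a b c d h1 h2 l1 l2 l3
    rcases Finset.mem_insert.1 h1 with h1 | h1
    · rw [Prod.mk.injEq] at h1
      rcases Finset.mem_insert.1 h2 with h2 | h2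
      · rw [Prod.mk.injEq] at h2; omega
      · have := dpairs_spec h2; omega
    rcases Finset.mem_insert.1 h2 with h2 | h2
    · rw [Prod.mk.injEq] at h2; omega
    obtain ⟨a1, a2, a3⟩ := mem_dpairs.1 h1
    obtain ⟨b1, b2, b3⟩ := mem_dpairs.1 h2
    refine T.noncrossing _ a3 _ b3 ⟨⟨a, by omega⟩, ⟨b, a2⟩, ⟨c, by omega⟩, ⟨d, b2⟩, ?_, ?_, l1, l2, l3⟩
    · exact pair_eq (⟨a, by omega⟩ : Fin n) ⟨b, a2⟩
    · exact pair_eq (⟨c, by omega⟩ : Fin n) ⟨d, b2⟩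

lemma pair_mem {n : ℕ} {T : PolyTriangulation n} {i j : Fin n} (hij : i.val < j.val)
    (h : {i, j} ∈ T.diags) : (i.val, j.val) ∈ dpairs T :=
  mem_dpairs.2 ⟨hij, j.isLt, by rw [pair_eq]; exact h⟩

lemma chords_tight {n : ℕ} (T : PolyTriangulation n) (hn : 3 ≤ n) : Tight (chords T) 0 (n - 1) := by
  refine ⟨by omega, ?_⟩
  have e1 : inside (chords T) 0 (n - 1) = chords T := by
    apply Finset.filter_true_of_mem
    rintro ⟨a, b⟩ h
    refine ⟨Nat.zero_le _, ?_⟩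
    rcases Finset.mem_insert.1 h with h | h
    · rw [Prod.mk.injEq] at h; simp only; omega
    · have := dpairs_spec h; simp only; omega
  have e2 : (chords T).card = (dpairs T).card + 1 := by
    apply Finset.card_insert_of_notMem
    intro h
    exact (dpairs_spec h).2.2 ⟨rfl, rfl⟩
  have e3 : T.diags ⊆ (dpairs T).image (fun p => pair n p.1 p.2) := by
    intro e he
    obtain ⟨i, j, hij, -, rfl⟩ := T.diags_valid e he
    rw [Finset.mem_image]
    rcases lt_or_gt_of_ne (fun h => hij (Fin.ext h) : i.val ≠ j.val) with h | h
    · exact ⟨(i.val, j.val), pair_mem h he, pair_eq i j⟩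
    · rw [Finset.pair_comm] at he ⊢
      exact ⟨(j.val, i.val), pair_mem h he, pair_eq j i⟩
  have e4 := (Finset.card_le_card e3).trans Finset.card_image_le
  rw [T.maximal] at e4
  rw [e1, e2]
  omega

lemma edge_adj {n : ℕ} {T : PolyTriangulation n} {i j : Fin n} (hij : i.val < j.val)
    (h : T.isEdge {i, j}) : Adj (chords T) i.val j.val := by
  rcases h with ⟨u, v, _, hadj, he⟩ | h
  · rw [← pair_eq] at he
    have hv := pair_vals hij j.isLt he
    have m1 := succ_mod u.isLt
    have m2 := succ_mod v.isLt
    simp only [adjOnCycle] at hadj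
    by_cases hs : j.val = i.val + 1
    · exact Or.inl hs
    · right
      have : i.val = 0 ∧ j.val = n - 1 := by omega
      rw [this.1, this.2]
      exact Finset.mem_insert_self _ _
  · exact Or.inr (Finset.mem_insert_of_mem (pair_mem hij h))

/-- reduction to ordered triangles -/
lemma transfer {n : ℕ} (T : PolyTriangulation n) (_hn : 3 ≤ n) {D : Finset (Finset (Fin n))}
    (hD : ∀ e ∈ D, isBoundaryEdge n e)
    (h : ∀ a b c : Fin n, a.val < b.val → b.val < c.val → Adj (chords T) a.val b.val →
      Adj (chords T) b.val c.val → Adj (chords T) a.val c.val →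
      ((∃ e ∈ D, a ∈ e) ∧ (∃ e ∈ D, b ∈ e)) ∨ ((∃ e ∈ D, a ∈ e) ∧ (∃ e ∈ D, c ∈ e)) ∨
      ((∃ e ∈ D, b ∈ e) ∧ (∃ e ∈ D, c ∈ e))) : EdgeTwoDominating T D := by
  refine ⟨hD, ?_⟩
  have key : ∀ a b c : Fin n, a.val < b.val → b.val < c.val → T.isEdge {a, b} →
      T.isEdge {a, c} → T.isEdge {b, c} →
      2 ≤ (({a, b, c} : Finset (Fin n)).filter (fun v => ∃ e ∈ D, v ∈ e)).card := by
    intro a b c hab hbc e1 e2 e3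
    have two : ∀ u v : Fin n, u ≠ v → u ∈ ({a, b, c} : Finset (Fin n)) →
        v ∈ ({a, b, c} : Finset (Fin n)) → (∃ e ∈ D, u ∈ e) → (∃ e ∈ D, v ∈ e) →
        2 ≤ (({a, b, c} : Finset (Fin n)).filter (fun v => ∃ e ∈ D, v ∈ e)).card := by
      intro u v huv hu hv cu cv
      rw [← Finset.card_pair huv]
      apply Finset.card_le_card
      intro w hw
      rw [Finset.mem_insert, Finset.mem_singleton] at hw
      rcases hw with rfl | rfl
      · exact Finset.mem_filter.2 ⟨hu, cu⟩
      · exact Finset.mem_filter.2 ⟨hv, cv⟩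
    have n1 : a ≠ b := fun h => by rw [h] at hab; omega
    have n2 : b ≠ c := fun h => by rw [h] at hbc; omega
    have n3 : a ≠ c := fun h => by rw [h] at hab; omega
    rcases h a b c hab hbc (edge_adj hab e1) (edge_adj hbc e3)
      (edge_adj (hab.trans hbc) e2) with h | h | h
    · exact two a b n1 (by simp) (by simp) h.1 h.2
    · exact two a c n3 (by simp) (by simp) h.1 h.2
    · exact two b c n2 (by simp) (by simp) h.1 h.2
  rintro t ⟨a, b, c, n1, n2, n3, rfl, e1, e2, e3⟩
  have n1' : a.val ≠ b.val := fun h => n1 (Fin.ext h)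
  have n2' : a.val ≠ c.val := fun h => n2 (Fin.ext h)
  have n3' : b.val ≠ c.val := fun h => n3 (Fin.ext h)
  have f1 : T.isEdge {b, a} := by rw [Finset.pair_comm]; exact e1
  have f2 : T.isEdge {c, a} := by rw [Finset.pair_comm]; exact e2
  have f3 : T.isEdge {c, b} := by rw [Finset.pair_comm]; exact e3
  have p1 : ({a, b, c} : Finset (Fin n)) = {a, c, b} := by ext; simp; tauto
  have p2 : ({a, b, c} : Finset (Fin n)) = {b, a, c} := by ext; simp; tauto
  have p3 : ({a, b, c} : Finset (Fin n)) = {b, c, a} := by ext; simp; tauto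
  have p4 : ({a, b, c} : Finset (Fin n)) = {c, a, b} := by ext; simp; tauto
  have p5 : ({a, b, c} : Finset (Fin n)) = {c, b, a} := by ext; simp; tauto
  rcases lt_or_gt_of_ne n1' with l1 | l1 <;> rcases lt_or_gt_of_ne n2' with l2 | l2 <;>
    rcases lt_or_gt_of_ne n3' with l3 | l3
  · exact key a b c l1 l3 e1 e2 e3
  · rw [p1]; exact key a c b l2 l3 e2 e1 f3
  · omega
  · rw [p4]; exact key c a b l2 l1 f2 f3 e1
  · rw [p2]; exact key b a c l1 l2 f1 e3 e2
  · omega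
  · rw [p3]; exact key b c a l3 l2 e3 f1 f2
  · rw [p5]; exact key c b a l3 l1 f3 f2 f1

end ETD

/-- every triangulation graph with `n ≥ 3` vertices has an edge
2-dominating set of size at most `⌊3n/7⌋`, except for `n = 4`, where one
additional edge is required (size `2`). -/
theorem edge_two_dominating_weak (n : ℕ) (hn : 3 ≤ n) (T : PolyTriangulation n) :
    (n ≠ 4 → ∃ D : Finset (Finset (Fin n)),
        EdgeTwoDominating T D ∧ D.card ≤ 3 * n / 7) ∧
    (n = 4 → ∃ D : Finset (Finset (Fin n)),
        EdgeTwoDominating T D ∧ D.card = 2) := by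
  have hS : ETD.NC (ETD.chords T) := ETD.chords_nc T hn
  have ht : ETD.Tight (ETD.chords T) 0 (n - 1) := ETD.chords_tight T hn
  constructor
  · intro hn4
    rcases ETD.final hS hn hn4 ht with ⟨D, h1, h2, -, -, h5⟩ | ⟨t, ht', D, h1, h2, -, -, h5⟩
    · refine ⟨D.image (ETD.pr n), ETD.transfer T hn ?_ ?_, Finset.card_image_le.trans h2⟩
      · intro e he
        obtain ⟨m, hm, rfl⟩ := Finset.mem_image.1 he
        exact ETD.pr_boundary hn (by have := h1 m hm; omega)
      · intro a b c hab hbc e1 e2 e3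
        have hc : ∀ v : Fin n, ETD.Cov 0 (n - 1) 0 0 D v.val →
            ∃ e ∈ D.image (ETD.pr n), v ∈ e := by
          rintro v (h | ⟨m, h, h'⟩ | ⟨-, h⟩ | ⟨-, h⟩)
          · exact ⟨_, Finset.mem_image_of_mem _ h, ETD.mem_pr.2 (Or.inl rfl)⟩
          · exact ⟨_, Finset.mem_image_of_mem _ h, ETD.mem_pr.2 (Or.inr h'.symm)⟩
          · exact absurd h (by decide)
          · exact absurd h (by decide)
        rcases h5 a b c (by omega) hab hbc (by omega) e1 e2 e3 with h | h | h
        · exact Or.inl ⟨hc _ h.1, hc _ h.2⟩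
        · exact Or.inr (Or.inl ⟨hc _ h.1, hc _ h.2⟩)
        · exact Or.inr (Or.inr ⟨hc _ h.1, hc _ h.2⟩)
    · refine ⟨insert (ETD.rootEdge n) (D.image (ETD.pr n)), ETD.transfer T hn ?_ ?_, ?_⟩
      · intro e he
        rcases Finset.mem_insert.1 he with rfl | he
        · exact ETD.root_boundary hn
        obtain ⟨m, hm, rfl⟩ := Finset.mem_image.1 he
        exact ETD.pr_boundary hn (by have := h1 m hm; omega)
      · intro a b c hab hbc e1 e2 e3
        have hc : ∀ v : Fin n, ETD.Cov 0 (n - 1) 1 1 D v.val →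
            ∃ e ∈ insert (ETD.rootEdge n) (D.image (ETD.pr n)), v ∈ e := by
          rintro v (h | ⟨m, h, h'⟩ | ⟨h, -⟩ | ⟨h, -⟩)
          · exact ⟨_, Finset.mem_insert_of_mem (Finset.mem_image_of_mem _ h),
              ETD.mem_pr.2 (Or.inl rfl)⟩
          · exact ⟨_, Finset.mem_insert_of_mem (Finset.mem_image_of_mem _ h),
              ETD.mem_pr.2 (Or.inr h'.symm)⟩
          · exact ⟨_, Finset.mem_insert_self _ _, ETD.mem_root.2 (Or.inl h)⟩
          · exact ⟨_, Finset.mem_insert_self _ _, ETD.mem_root.2 (Or.inr h)⟩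
        rcases h5 a b c (by omega) hab hbc (by omega) e1 e2 e3 with h | h | h
        · exact Or.inl ⟨hc _ h.1, hc _ h.2⟩
        · exact Or.inr (Or.inl ⟨hc _ h.1, hc _ h.2⟩)
        · exact Or.inr (Or.inr ⟨hc _ h.1, hc _ h.2⟩)
      · have e1 := Finset.card_insert_le (ETD.rootEdge n) (D.image (ETD.pr n))
        have e2 : (D.image (ETD.pr n)).card ≤ D.card := Finset.card_image_le
        omega
  · intro h4
    subst h4
    refine ⟨{ETD.pr 4 0, ETD.pr 4 2}, ETD.transfer T hn ?_ ?_, by decide⟩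
    · intro e he
      rcases Finset.mem_insert.1 he with rfl | he
      · exact ETD.pr_boundary hn (by omega)
      · rw [Finset.mem_singleton.1 he]
        exact ETD.pr_boundary hn (by omega)
    · intro a b c _ _ _ _ _
      have hc : ∀ v : Fin 4, ∃ e ∈ ({ETD.pr 4 0, ETD.pr 4 2} : Finset (Finset (Fin 4))), v ∈ e := by
        decide
      exact Or.inl ⟨hc a, hc b⟩
end
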